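/- arXiv:1108.1791 — 5 statements merged into one kernel-verified Lean document; each statement's English description precedes it below -/
import Mathlib

section
/- (Valiant's PAC-learning theorem.) Let S be a measurable space, D a probability measure on S, H a finite nonempty class of measurable functions S → Bool, f ∈ H, and let ε ∈ (0,1) and δ ∈ (0,1). If m is a natural number with m ≥ (1/ε)·ln(|H|/δ), then with probability at least 1 − δ when x₁, …, x_m are drawn independently from D (i.e., under the m-fold product measure D^m), the sample (x₁, …, x_m) is reliable: every h ∈ H satisfying h(xᵢ) = f(xᵢ) for all i ∈ {1, …, m} is good, meaning D({x : h(x) = f(x)}) ≥ 1 − ε. -/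
open MeasureTheory

/-- Valiant's PAC-learning theorem: if `m ≥ (1/ε)·ln(|H|/δ)`, then with probability at
least `1 − δ` over `m` i.i.d. samples from `D`, every hypothesis `h ∈ H` consistent with
the target `f ∈ H` on the sample is good, i.e. `D({x : h(x) = f(x)}) ≥ 1 − ε`. -/
theorem valiant_pac_learning
    {S : Type*} [MeasurableSpace S] (D : Measure S) [IsProbabilityMeasure D]
    (H : Finset (S → Bool)) (hHne : H.Nonempty) (hHmeas : ∀ h ∈ H, Measurable h)
    (f : S → Bool) (hf : f ∈ H)
    (ε δ : ℝ) (hε : ε ∈ Set.Ioo (0:ℝ) 1) (hδ : δ ∈ Set.Ioo (0:ℝ) 1)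
    (m : ℕ) (hm : (1 / ε) * Real.log ((H.card : ℝ) / δ) ≤ (m : ℝ)) :
    1 - δ ≤
      ((Measure.pi fun _ : Fin m => D)
        {x : Fin m → S | ∀ h ∈ H, (∀ i, h (x i) = f (x i)) →
          1 - ε ≤ (D {s | h s = f s}).toReal}).toReal := by
  obtain ⟨hε0, hε1⟩ := hε
  obtain ⟨hδ0, hδ1⟩ := hδ
  classical
  set μ := Measure.pi fun _ : Fin m => D with hμ
  set G : Set (Fin m → S) := {x : Fin m → S | ∀ h ∈ H, (∀ i, h (x i) = f (x i)) →
          1 - ε ≤ (D {s | h s = f s}).toReal} with hG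
  change 1 - δ ≤ μ.real G
  let bad := H.filter fun h => (D {s | h s = f s}).toReal < 1 - ε
  let B : Set (Fin m → S) := ⋃ h ∈ bad, Set.pi Set.univ fun _ : Fin m => {s | h s = f s}
  have hcover : (Set.univ : Set (Fin m → S)) ⊆ G ∪ B := by
    intro x _
    by_cases hx : x ∈ G
    · exact Or.inl hx
    · right
      simp only [hG, Set.mem_setOf_eq, not_forall, not_le] at hx
      obtain ⟨h, hh, hc, hb⟩ := hx
      simp only [B, Set.mem_iUnion]
      exact ⟨h, Finset.mem_filter.2 ⟨hh, hb⟩, fun i _ => hc i⟩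
  have h1 : (1 : ℝ) ≤ μ.real G + μ.real B := by
    calc (1 : ℝ) = μ.real Set.univ := by simp
      _ ≤ μ.real (G ∪ B) := measureReal_mono hcover
      _ ≤ _ := measureReal_union_le _ _
  have hcard : (0 : ℝ) < H.card := by exact_mod_cast hHne.card_pos
  have h2 : μ.real B ≤ H.card * (1 - ε) ^ m := by
    calc μ.real B ≤ ∑ h ∈ bad, μ.real (Set.pi Set.univ fun _ : Fin m => {s | h s = f s}) :=
          measureReal_biUnion_finset_le _ _
      _ ≤ ∑ h ∈ bad, (1 - ε) ^ m := by
          refine Finset.sum_le_sum fun h hh => ?_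
          have hb := (Finset.mem_filter.1 hh).2
          rw [measureReal_def, hμ, Measure.pi_pi]
          simp only [Finset.prod_const, Finset.card_univ, Fintype.card_fin, ENNReal.toReal_pow]
          exact pow_le_pow_left₀ ENNReal.toReal_nonneg hb.le m
      _ = bad.card * (1 - ε) ^ m := by simp
      _ ≤ _ := by
          have : (bad.card : ℝ) ≤ H.card := by exact_mod_cast Finset.card_filter_le _ _
          exact mul_le_mul_of_nonneg_right this (pow_nonneg (by linarith) m)
  have h3 : (1 - ε) ^ m ≤ δ / H.card := by
    have hlog : Real.log (H.card / δ) ≤ m * ε := by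
      have := mul_le_mul_of_nonneg_right hm hε0.le
      have e : 1 / ε * Real.log (H.card / δ) * ε = Real.log (H.card / δ) := by
        field_simp
      linarith
    calc (1 - ε) ^ m ≤ (Real.exp (-ε)) ^ m :=
          pow_le_pow_left₀ (by linarith) (Real.one_sub_le_exp_neg ε) m
      _ = Real.exp (-(m * ε)) := by rw [← Real.exp_nat_mul]; ring_nf
      _ ≤ Real.exp (-Real.log (H.card / δ)) := Real.exp_le_exp.2 (by linarith)
      _ = δ / H.card := by
          rw [Real.exp_neg, Real.exp_log (by positivity), inv_div]
  have h4 : (H.card : ℝ) * (1 - ε) ^ m ≤ δ := by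
    have := (le_div_iff₀ hcard).1 h3
    linarith
  linarith
end

section
/- (Union bound over bad hypotheses.) Let S be a measurable space, D a probability measure on S, H a finite class of measurable functions S → Bool, f ∈ H, ε ∈ [0,1], and m a natural number. Then the probability, under the m-fold product measure D^m, that there exists some bad hypothesis h ∈ H (i.e., one with D({x : h(x) = f(x)}) < 1 − ε) satisfying h(xᵢ) = f(xᵢ) for all i ∈ {1, …, m} is at most |H|·(1 − ε)^m. -/
open MeasureTheory

/-- Union bound over bad hypotheses: the probability, under the `m`-fold product measure,
that some bad hypothesis `h ∈ H` (one with `D({x : h(x) = f(x)}) < 1 − ε`) agrees with the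
target `f` on all `m` sample points is at most `|H|·(1 − ε)^m`. -/
theorem union_bound_bad_hypotheses
    {S : Type*} [MeasurableSpace S] (D : Measure S) [IsProbabilityMeasure D]
    (H : Finset (S → Bool)) (hHmeas : ∀ h ∈ H, Measurable h)
    (f : S → Bool) (hf : f ∈ H)
    (ε : ℝ) (hε : ε ∈ Set.Icc (0:ℝ) 1) (m : ℕ) :
    ((Measure.pi fun _ : Fin m => D)
      {x : Fin m → S | ∃ h ∈ H, (D {s | h s = f s}).toReal < 1 - ε ∧
        ∀ i, h (x i) = f (x i)}).toReal ≤ (H.card : ℝ) * (1 - ε) ^ m := by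
  classical
  set P := Measure.pi fun _ : Fin m => D with hP
  haveI : IsProbabilityMeasure P := by rw [hP]; infer_instance
  have h1ε : 0 ≤ 1 - ε := by linarith [hε.2]
  have hsub : {x : Fin m → S | ∃ h ∈ H, (D {s | h s = f s}).toReal < 1 - ε ∧
        ∀ i, h (x i) = f (x i)} ⊆
      ⋃ h ∈ H.filter (fun h => (D {s | h s = f s}).toReal < 1 - ε),
        Set.pi Set.univ (fun _ : Fin m => {s | h s = f s}) := by
    rintro x ⟨h, hh, hb, hx⟩
    simp only [Set.mem_iUnion]
    exact ⟨h, Finset.mem_filter.2 ⟨hh, hb⟩, fun i _ => hx i⟩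
  calc _ ≤ P.real (⋃ h ∈ H.filter (fun h => (D {s | h s = f s}).toReal < 1 - ε),
        Set.pi Set.univ (fun _ : Fin m => {s | h s = f s})) := measureReal_mono hsub (measure_ne_top P _)
    _ ≤ ∑ h ∈ H.filter (fun h => (D {s | h s = f s}).toReal < 1 - ε),
        P.real (Set.pi Set.univ (fun _ : Fin m => {s | h s = f s})) :=
      measureReal_biUnion_finset_le _ _
    _ ≤ ∑ h ∈ H.filter (fun h => (D {s | h s = f s}).toReal < 1 - ε), (1 - ε) ^ m := by
      refine Finset.sum_le_sum fun h hh => ?_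
      have hb := (Finset.mem_filter.1 hh).2
      rw [measureReal_def, hP, Measure.pi_pi]
      simp only [Finset.prod_const, Finset.card_univ, Fintype.card_fin, ENNReal.toReal_pow]
      exact pow_le_pow_left₀ ENNReal.toReal_nonneg hb.le m
    _ ≤ (H.card : ℝ) * (1 - ε) ^ m := by
      rw [Finset.sum_const, nsmul_eq_mul]
      gcongr
      exact Finset.filter_subset _ _
end

section
/- (No-free-lunch from a shattered set.) Let S be a type, m ≥ 1 a natural number, T a finite subset of S with |T| = 2m, and H a class of functions S → Bool that shatters T. Let D be the uniform probability distribution on T. Then for every learner A : (S × Bool)^m → (S → Bool) (a function taking m labeled examples to a hypothesis), there exists f ∈ H such that the expected error of A is at least 1/4; that is, the expectation, over x₁, …, x_m drawn independently from D, of D({s : A((x₁, f(x₁)), …, (x_m, f(x_m)))(s) ≠ f(s)}) is at least 1/4. -/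
/-- For an unseen point `s`, exactly half of the labelings of `T` disagree with the learner. -/
lemma nfl_half {S : Type*} [DecidableEq S] (m : ℕ) (T : Finset S)
    (A : (Fin m → S × Bool) → (S → Bool)) (x : Fin m → S) (s : S) (hs : s ∈ T)
    (hx : ∀ i, x i ≠ s) :
    2 * (T.powerset.filter fun U =>
      A (fun i => (x i, decide (x i ∈ U))) s ≠ decide (s ∈ U)).card = 2 ^ T.card := by
  have key : ∀ U : Finset S, (fun i => (x i, decide (x i ∈ symmDiff U {s})))
      = (fun i => (x i, decide (x i ∈ U))) := by
    intro U
    funext i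
    have := hx i
    simp [Finset.mem_symmDiff, this]
  have hmem : ∀ U : Finset S, decide (s ∈ symmDiff U {s}) = !decide (s ∈ U) := by
    intro U
    simp [Finset.mem_symmDiff]
  have hsub : ∀ U ∈ T.powerset, symmDiff U {s} ∈ T.powerset := by
    intro U hU
    rw [Finset.mem_powerset] at *
    intro y hy
    rw [Finset.mem_symmDiff] at hy
    rcases hy with h | h
    · exact hU h.1
    · rw [Finset.mem_singleton.1 h.1]; exact hs
  have h1 : (T.powerset.filter fun U =>
      A (fun i => (x i, decide (x i ∈ U))) s ≠ decide (s ∈ U)).card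
      = (T.powerset.filter fun U =>
      ¬ (A (fun i => (x i, decide (x i ∈ U))) s ≠ decide (s ∈ U))).card := by
    apply Finset.card_nbij' (fun U => symmDiff U {s}) (fun U => symmDiff U {s})
    · intro U hU
      have hU := Finset.mem_filter.1 hU
      refine Finset.mem_filter.2 ⟨hsub U hU.1, ?_⟩
      have h2 := hU.2
      beta_reduce
      rw [key, hmem]
      revert h2
      cases A (fun i => (x i, decide (x i ∈ U))) s <;> cases decide (s ∈ U) <;> simp
    · intro U hU
      have hU := Finset.mem_filter.1 hU
      refine Finset.mem_filter.2 ⟨hsub U hU.1, ?_⟩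
      have h2 := hU.2
      beta_reduce
      rw [key, hmem]
      revert h2
      cases A (fun i => (x i, decide (x i ∈ U))) s <;> cases decide (s ∈ U) <;> simp
    · intro U _
      exact symmDiff_symmDiff_cancel_right _ _
    · intro U _
      exact symmDiff_symmDiff_cancel_right _ _
  have h2 := Finset.card_filter_add_card_filter_not (s := T.powerset) (fun U =>
      A (fun i => (x i, decide (x i ∈ U))) s ≠ decide (s ∈ U))
  rw [Finset.card_powerset] at h2
  omega

/-- For a fixed sample, the total error summed over all labelings of `T`. -/
lemma nfl_sample {S : Type*} [DecidableEq S] (m : ℕ) (T : Finset S) (hT : T.card = 2 * m)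
    (A : (Fin m → S × Bool) → (S → Bool)) (x : Fin m → S) :
    m * 2 ^ T.card ≤ 2 * ∑ U ∈ T.powerset, (T.filter fun s =>
      A (fun i => (x i, decide (x i ∈ U))) s ≠ decide (s ∈ U)).card := by
  have hswap : ∑ U ∈ T.powerset, (T.filter fun s =>
      A (fun i => (x i, decide (x i ∈ U))) s ≠ decide (s ∈ U)).card
      = ∑ s ∈ T, (T.powerset.filter fun U =>
      A (fun i => (x i, decide (x i ∈ U))) s ≠ decide (s ∈ U)).card := by
    simp only [Finset.card_filter]
    exact Finset.sum_comm
  rw [hswap, Finset.mul_sum]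
  have hcard : m ≤ (T \ Finset.univ.image x).card := by
    have h1 := Finset.le_card_sdiff (Finset.univ.image x) T
    have h2 : (Finset.univ.image x).card ≤ m := by
      simpa using Finset.card_image_le (s := (Finset.univ : Finset (Fin m))) (f := x)
    omega
  calc m * 2 ^ T.card ≤ (T \ Finset.univ.image x).card * 2 ^ T.card :=
        Nat.mul_le_mul_right _ hcard
    _ = ∑ s ∈ T \ Finset.univ.image x, 2 ^ T.card := by simp
    _ = ∑ s ∈ T \ Finset.univ.image x, 2 * (T.powerset.filter fun U =>
      A (fun i => (x i, decide (x i ∈ U))) s ≠ decide (s ∈ U)).card := by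
        refine Finset.sum_congr rfl fun s hs => (nfl_half m T A x s ?_ ?_).symm
        · exact (Finset.mem_sdiff.1 hs).1
        · intro i hi
          exact (Finset.mem_sdiff.1 hs).2 (Finset.mem_image.2 ⟨i, Finset.mem_univ _, hi⟩)
    _ ≤ _ := Finset.sum_le_sum_of_subset Finset.sdiff_subset

/-- No-free-lunch from a shattered set: if `H` shatters a set `T` of size `2m` and `D` is
the uniform distribution on `T`, then for every learner `A` mapping `m` labeled examples
to a hypothesis, there is a target `f ∈ H` whose expected error (over `m` i.i.d. uniform
samples from `T`) is at least `1/4`. -/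
theorem no_free_lunch
    {S : Type*} [DecidableEq S] (m : ℕ) (hm : 1 ≤ m)
    (T : Finset S) (hT : T.card = 2 * m)
    (H : Set (S → Bool))
    (hshat : ∀ g : S → Bool, ∃ h ∈ H, ∀ x ∈ T, h x = g x)
    (A : (Fin m → S × Bool) → (S → Bool)) :
    ∃ f ∈ H,
      (1 / 4 : ℝ) ≤
        (1 / (T.card : ℝ) ^ m) *
          ∑ x ∈ Fintype.piFinset (fun _ : Fin m => T),
            (((T.filter fun s => A (fun i => (x i, f (x i))) s ≠ f s).card : ℝ) /
              (T.card : ℝ)) := by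
  have hex : ∃ U ∈ T.powerset, m * (2 * m) ^ m ≤ 2 * ∑ x ∈ Fintype.piFinset (fun _ : Fin m => T),
      (T.filter fun s => A (fun i => (x i, decide (x i ∈ U))) s ≠ decide (s ∈ U)).card := by
    apply Finset.exists_le_of_sum_le (Finset.powerset_nonempty T)
    rw [← Finset.mul_sum _ _ 2, Finset.sum_comm, Finset.mul_sum]
    calc ∑ _U ∈ T.powerset, m * (2 * m) ^ m
        = ∑ _x ∈ Fintype.piFinset (fun _ : Fin m => T), m * 2 ^ T.card := by
          simp [Fintype.card_piFinset, hT]; ring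
      _ ≤ _ := Finset.sum_le_sum fun x _ => nfl_sample m T hT A x
  obtain ⟨U, -, hU⟩ := hex
  obtain ⟨f, hf, hfU⟩ := hshat (fun s => decide (s ∈ U))
  refine ⟨f, hf, ?_⟩
  have heq : ∑ x ∈ Fintype.piFinset (fun _ : Fin m => T),
      (T.filter fun s => A (fun i => (x i, decide (x i ∈ U))) s ≠ decide (s ∈ U)).card
      = ∑ x ∈ Fintype.piFinset (fun _ : Fin m => T),
      (T.filter fun s => A (fun i => (x i, f (x i))) s ≠ f s).card := by
    refine Finset.sum_congr rfl fun x hx => ?_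
    have hx' : (fun i => (x i, f (x i))) = (fun i => (x i, decide (x i ∈ U))) := by
      funext i
      rw [hfU _ (Fintype.mem_piFinset.1 hx i)]
    rw [hx']
    congr 1
    refine Finset.filter_congr fun s hs => ?_
    rw [hfU s hs]
  rw [heq] at hU
  rw [← Finset.sum_div, ← Nat.cast_sum, hT]
  have hU' : (m : ℝ) * (2 * m) ^ m ≤ 2 * ((∑ x ∈ Fintype.piFinset (fun _ : Fin m => T),
      (T.filter fun s => A (fun i => (x i, f (x i))) s ≠ f s).card : ℕ) : ℝ) := by
    exact_mod_cast hU
  have hm0 : (0 : ℝ) < m := by exact_mod_cast hm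
  rw [div_mul_div_comm, one_mul, div_le_div_iff₀ (by norm_num) (by positivity)]
  push_cast at hU' ⊢
  linarith
end

section
/- (Deutsch fixed-point theorem, quantum case.) Let n ≥ 1 and let S be a ℂ-linear map from n × n complex matrices to n × n complex matrices such that S maps every positive semidefinite matrix to a positive semidefinite matrix and preserves the trace (trace(S(A)) = trace(A) for all A). Then there exists a density matrix fixed by S: a matrix ρ that is positive semidefinite, has trace 1, and satisfies S(ρ) = ρ. -/
open scoped ComplexOrder

open Filter Topology in
/-- Entries of a density matrix are bounded by one. -/
lemma density_entry_le {n : ℕ} (A : Matrix (Fin n) (Fin n) ℂ) (hA : A.PosSemidef)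
    (ht : A.trace = 1) (i j : Fin n) : ‖A i j‖ ≤ 1 := by
  obtain ⟨B, rfl⟩ : ∃ B : Matrix (Fin n) (Fin n) ℂ, A = B.conjTranspose * B := by
    open scoped MatrixOrder in
    exact CStarAlgebra.nonneg_iff_eq_star_mul_self.mp hA.nonneg
  have h1 : ∑ a, ∑ k, ‖B k a‖ ^ 2 = 1 := by
    have : ((∑ a, ∑ k, ‖B k a‖ ^ 2 : ℝ) : ℂ) = 1 := by
      rw [← ht]
      simp only [Matrix.trace, Matrix.diag, Matrix.mul_apply, Matrix.conjTranspose_apply]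
      push_cast
      refine Finset.sum_congr rfl fun a _ => Finset.sum_congr rfl fun k _ => ?_
      exact (Complex.conj_mul' (B k a)).symm
    exact_mod_cast this
  have hc : ∀ a, ∑ k, ‖B k a‖ ^ 2 ≤ 1 := fun a => by
    rw [← h1]
    exact Finset.single_le_sum (f := fun a => ∑ k, ‖B k a‖ ^ 2)
      (fun _ _ => Finset.sum_nonneg fun _ _ => by positivity) (Finset.mem_univ a)
  rw [Matrix.mul_apply]
  calc ‖∑ k, B.conjTranspose i k * B k j‖ ≤ ∑ k, ‖B.conjTranspose i k * B k j‖ := norm_sum_le _ _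
    _ ≤ ∑ k, (‖B k i‖ ^ 2 / 2 + ‖B k j‖ ^ 2 / 2) := by
        refine Finset.sum_le_sum fun k _ => ?_
        rw [norm_mul, Matrix.conjTranspose_apply, norm_star]
        nlinarith [sq_nonneg (‖B k i‖ - ‖B k j‖)]
    _ = (∑ k, ‖B k i‖ ^ 2) / 2 + (∑ k, ‖B k j‖ ^ 2) / 2 := by
        rw [Finset.sum_add_distrib, Finset.sum_div, Finset.sum_div]
    _ ≤ 1 := by linarith [hc i, hc j]

/-- The set of density matrices is compact. -/
lemma density_isCompact (n : ℕ) :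
    IsCompact {A : Matrix (Fin n) (Fin n) ℂ | A.PosSemidef ∧ A.trace = 1} := by
  have hK : IsCompact (Set.pi Set.univ fun _ : Fin n =>
      Set.pi Set.univ fun _ : Fin n => Metric.closedBall (0 : ℂ) 1) :=
    isCompact_univ_pi fun _ => isCompact_univ_pi fun _ => isCompact_closedBall _ _
  have hcl : IsClosed {A : Matrix (Fin n) (Fin n) ℂ | A.PosSemidef ∧ A.trace = 1} := by
    have : {A : Matrix (Fin n) (Fin n) ℂ | A.PosSemidef ∧ A.trace = 1} =
        ({A | A.conjTranspose = A} ∩ ⋂ x : Fin n → ℂ, {A | 0 ≤ star x ⬝ᵥ (A.mulVec x)}) ∩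
          {A | A.trace = 1} := by
      ext A
      simp [Matrix.posSemidef_iff_dotProduct_mulVec, Matrix.IsHermitian]
    rw [this]
    refine (IsClosed.inter ?_ (isClosed_iInter fun x => ?_)).inter ?_
    · exact isClosed_eq (by fun_prop) continuous_id
    · exact isClosed_le continuous_const (by fun_prop)
    · exact isClosed_eq (by fun_prop) continuous_const
  refine hK.of_isClosed_subset hcl ?_
  rintro A ⟨hA, ht⟩ i - j -
  simpa using density_entry_le A hA ht i j

open Filter Topology in
/-- Deutsch fixed-point theorem, quantum case: every ℂ-linear, positivity-preserving,
trace-preserving map `S` on `n × n` complex matrices (`n ≥ 1`) has a fixed density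
matrix: some positive semidefinite `ρ` with trace `1` and `S ρ = ρ`. -/
theorem deutsch_quantum_fixed_point
    (n : ℕ) (hn : 1 ≤ n)
    (S : Matrix (Fin n) (Fin n) ℂ →ₗ[ℂ] Matrix (Fin n) (Fin n) ℂ)
    (hpos : ∀ A : Matrix (Fin n) (Fin n) ℂ, A.PosSemidef → (S A).PosSemidef)
    (htrace : ∀ A : Matrix (Fin n) (Fin n) ℂ, (S A).trace = A.trace) :
    ∃ ρ : Matrix (Fin n) (Fin n) ℂ, ρ.PosSemidef ∧ ρ.trace = 1 ∧ S ρ = ρ := by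
  have hn0 : (n : ℂ) ≠ 0 := by exact_mod_cast (by omega : n ≠ 0)
  let x : ℕ → Matrix (Fin n) (Fin n) ℂ := fun k => (S ^ k) ((n : ℂ)⁻¹ • 1)
  have hxs : ∀ k, S (x k) = x (k + 1) := fun k => by
    simp only [x, pow_succ', Module.End.mul_apply]
  have hx : ∀ k, (x k).PosSemidef ∧ (x k).trace = 1 := by
    intro k
    induction k with
    | zero =>
      refine ⟨?_, ?_⟩
      · simp only [x, pow_zero, Module.End.one_apply]
        exact Matrix.PosSemidef.one.smul (by positivity)
      · simp [x, hn0]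
    | succ k ih =>
      rw [← hxs]
      exact ⟨hpos _ ih.1, (htrace _).trans ih.2⟩
  let a : ℕ → Matrix (Fin n) (Fin n) ℂ :=
    fun N => ((N : ℂ) + 1)⁻¹ • ∑ k ∈ Finset.range (N + 1), x k
  have hN0 : ∀ N : ℕ, (N : ℂ) + 1 ≠ 0 := fun N => by exact_mod_cast Nat.succ_ne_zero N
  have ha : ∀ N, a N ∈ {A : Matrix (Fin n) (Fin n) ℂ | A.PosSemidef ∧ A.trace = 1} := by
    intro N
    refine ⟨?_, ?_⟩
    · exact (Matrix.posSemidef_sum _ fun k _ => (hx k).1).smul (by positivity)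
    · simp [a, Matrix.trace_smul, Matrix.trace_sum, (hx _).2, hN0 N]
  have hdiff : ∀ N, S (a N) - a N = ((N : ℂ) + 1)⁻¹ • (x (N + 1) - x 0) := by
    intro N
    simp only [a, map_smul, map_sum, hxs]
    rw [← smul_sub, ← Finset.sum_sub_distrib, Finset.sum_range_sub]
  have : FirstCountableTopology (Matrix (Fin n) (Fin n) ℂ) :=
    inferInstanceAs (FirstCountableTopology (Fin n → Fin n → ℂ))
  obtain ⟨ρ, hρ, φ, hφ, hlim⟩ := (density_isCompact n).tendsto_subseq ha
  refine ⟨ρ, hρ.1, hρ.2, ?_⟩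
  have hS : Continuous S := S.continuous_of_finiteDimensional
  have h1 : Tendsto (fun N => S (a (φ N)) - a (φ N)) atTop (𝓝 (S ρ - ρ)) :=
    ((hS.tendsto ρ).comp hlim).sub hlim
  have h2 : Tendsto (fun N => S (a N) - a N) atTop (𝓝 0) := by
    refine tendsto_pi_nhds.mpr ?_
    intro i
    refine tendsto_pi_nhds.mpr ?_
    intro j
    have h3 : Tendsto (fun N : ℕ => 2 * (1 / ((N : ℝ) + 1))) atTop (𝓝 0) := by
      simpa using (tendsto_one_div_add_atTop_nhds_zero_nat (𝕜 := ℝ)).const_mul 2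
    refine squeeze_zero_norm (fun N => ?_) h3
    rw [hdiff, Matrix.smul_apply, Matrix.sub_apply, norm_smul, norm_inv]
    have e : ‖(N : ℂ) + 1‖ = (N : ℝ) + 1 := by
      have := Complex.norm_natCast (N + 1)
      push_cast at this
      exact this
    rw [e, mul_comm, one_div]
    refine mul_le_mul_of_nonneg_right ?_ (by positivity)
    have b1 := density_entry_le _ (hx (N + 1)).1 (hx (N + 1)).2 i j
    have b2 := density_entry_le _ (hx 0).1 (hx 0).2 i j
    linarith [norm_sub_le (x (N + 1) i j) (x 0 i j)]
  exact sub_eq_zero.mp (tendsto_nhds_unique h1 (h2.comp hφ.tendsto_atTop))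
end

section
/- (Tightness of the PAC sample-complexity bound at ε = 0.) For every natural number m and every δ ∈ (0,1), there exist a finite measurable sample space S, a probability measure D on S, a two-element hypothesis class H of functions S → Bool, and f ∈ H, such that the probability under the m-fold product measure D^m that the sample (x₁, …, x_m) is reliable with error parameter ε = 0 is strictly less than 1 − δ. Here a sample is reliable with ε = 0 if every h ∈ H with h(xᵢ) = f(xᵢ) for all i satisfies D({x : h(x) = f(x)}) = 1. -/
open MeasureTheory

/-- Tightness of the PAC sample-complexity bound at `ε = 0`: for every sample size `m`
and confidence `δ ∈ (0,1)`, there are a finite measurable sample space, a probability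
measure `D`, a two-element hypothesis class `H`, and a target `f ∈ H`, such that the
probability that the sample is reliable with error parameter `ε = 0` (every `h ∈ H`
agreeing with `f` on the sample satisfies `D({x : h(x) = f(x)}) = 1`) is strictly less
than `1 − δ`. -/
theorem pac_eps_zero_tightness (m : ℕ) (δ : ℝ) (hδ : δ ∈ Set.Ioo (0:ℝ) 1) :
    ∃ (S : Type) (inst : MeasurableSpace S) (_ : Fintype S)
      (D : @Measure S inst) (_ : @IsProbabilityMeasure S inst D)
      (H : Finset (S → Bool)) (f : S → Bool),
      H.card = 2 ∧ f ∈ H ∧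
      ((@Measure.pi (Fin m) (fun _ => S) _ (fun _ => inst) (fun _ => D))
        {x : Fin m → S | ∀ h ∈ H, (∀ i, h (x i) = f (x i)) →
          D {s | h s = f s} = 1}).toReal < 1 - δ := by
  obtain ⟨h0, h1⟩ := hδ
  obtain ⟨p, hp0, hp1, hmp⟩ : ∃ p : ℝ, 0 < p ∧ p < 1 ∧ (m : ℝ) * p < 1 - δ := by
    have hm : (0 : ℝ) < (m : ℝ) + 1 := by positivity
    refine ⟨(1 - δ) / (m + 1), div_pos (by linarith) hm, ?_, ?_⟩
    · rw [div_lt_one hm]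
      have : (0 : ℝ) ≤ m := by positivity
      linarith
    · rw [mul_div_assoc', div_lt_iff₀ hm]
      nlinarith
  have hpow : δ < (1 - p) ^ m := by
    have := one_add_mul_le_pow (a := -p) (by linarith) m
    rw [← sub_eq_add_neg] at this
    linarith
  let D : Measure Bool := ENNReal.ofReal (1 - p) • Measure.dirac false
    + ENNReal.ofReal p • Measure.dirac true
  have hD : IsProbabilityMeasure D := by
    constructor
    simp only [D, Measure.add_apply, Measure.smul_apply, measure_univ, smul_eq_mul, mul_one]
    rw [← ENNReal.ofReal_add (by linarith) hp0.le]
    simp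
  have hDf : D {false} = ENNReal.ofReal (1 - p) := by
    simp [D]
  refine ⟨Bool, inferInstance, inferInstance, D, hD, {fun _ => false, id}, fun _ => false,
    ?_, by simp, ?_⟩
  · apply Finset.card_pair
    intro h
    have := congrFun h true
    simp at this
  · let P : Measure (Fin m → Bool) := Measure.pi (fun _ => D)
    let A : Set (Fin m → Bool) := Set.univ.pi (fun _ => {false})
    have hA : P.real A = (1 - p) ^ m := by
      simp only [P, A, Measure.real, Measure.pi_pi, hDf]
      simp [ENNReal.toReal_ofReal (show 0 ≤ 1 - p by linarith)]
    have hAm : MeasurableSet A := MeasurableSet.univ_pi (fun _ => measurableSet_singleton _)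
    have hc : P.real Aᶜ = 1 - (1 - p) ^ m := by
      rw [probReal_compl_eq_one_sub hAm, hA]
    have hsub : {x : Fin m → Bool | ∀ h ∈ ({fun _ => false, id} : Finset (Bool → Bool)),
        (∀ i, h (x i) = false) → D {s | h s = false} = 1} ⊆ Aᶜ := by
      intro x hx hxA
      have h2 := hx id (by simp) (fun i => by simpa [A] using hxA i (Set.mem_univ i))
      have h3 : {s : Bool | id s = false} = {false} := by ext s; simp
      rw [h3, hDf, ENNReal.ofReal_eq_one] at h2
      linarith
    have := measureReal_mono (μ := P) hsub
    change P.real _ < _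
    linarith
end
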